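/- Let X, Y, Z, A, B, C be random variables whose joint distribution factorizes as P_{XYZABC} = P_A · P_B · P_C · P_{X|BC} · P_{Y|AC} · P_{Z|AB}. Then for every integer s ≥ 1: (−s²/2 − 3s/2)·(H(X) + H(Z)) − (s+1)·H(Y) + (s²/2 + 3s/2 + 1)·(H(XY) + H(YZ)) + s(s+2)·H(XZ) − (s+1)²·H(XYZ) ≥ 0, and the same inequality holds for all permutations of the roles of X, Y and Z. -/

import Mathlib

open Finset
open scoped Classical

/-- Probability that the random variable `X` (on the finite weighted sample space
`(Ω, μ)`) takes the value `b`. -/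
noncomputable def pr {Ω β : Type*} [Fintype Ω] (μ : Ω → ℝ) (X : Ω → β) (b : β) : ℝ :=
  ∑ ω, if X ω = b then μ ω else 0

/-- Shannon entropy of the random variable `X` on the finite weighted sample space
`(Ω, μ)`. -/
noncomputable def ent {Ω β : Type*} [Fintype Ω] [Fintype β] (μ : Ω → ℝ) (X : Ω → β) : ℝ :=
  ∑ b, Real.negMulLog (pr μ X b)

/-- Mutual information `I(X : Y)`. -/
noncomputable def mi {Ω β γ : Type*} [Fintype Ω] [Fintype β] [Fintype γ]
    (μ : Ω → ℝ) (X : Ω → β) (Y : Ω → γ) : ℝ :=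
  ent μ X + ent μ Y - ent μ (fun ω => (X ω, Y ω))

/-- Conditional mutual information `I(X : Y | Z)`. -/
noncomputable def cmi {Ω β γ δ : Type*} [Fintype Ω] [Fintype β] [Fintype γ] [Fintype δ]
    (μ : Ω → ℝ) (X : Ω → β) (Y : Ω → γ) (Z : Ω → δ) : ℝ :=
  ent μ (fun ω => (X ω, Z ω)) + ent μ (fun ω => (Y ω, Z ω)) - ent μ Z
    - ent μ (fun ω => (X ω, Y ω, Z ω))

/-- The Ingleton quantity `I_ING(S,T;U,V)`. -/
noncomputable def ing {Ω β γ δ ε : Type*} [Fintype Ω] [Fintype β] [Fintype γ] [Fintype δ]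
    [Fintype ε] (μ : Ω → ℝ) (S : Ω → β) (T : Ω → γ) (U : Ω → δ) (V : Ω → ε) : ℝ :=
  cmi μ S T U + cmi μ S T V + mi μ U V - mi μ S T

/-- The marginal inequality (14) of Proposition 4 (family derived from the first Matúš
family), with roles `(P, Q, R)` standing for a permutation of `(X, Y, Z)`:
`(−s²/2 − 3s/2)(H(P) + H(R)) − (s+1)H(Q) + (s²/2 + 3s/2 + 1)(H(PQ) + H(QR))
  + s(s+2)H(PR) − (s+1)²H(PQR) ≥ 0`. -/
def matusMarg1 {Ω β γ δ : Type*} [Fintype Ω] [Fintype β] [Fintype γ] [Fintype δ]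
    (s : ℝ) (μ : Ω → ℝ) (P : Ω → β) (Q : Ω → γ) (R : Ω → δ) : Prop :=
  0 ≤ (-(s ^ 2) / 2 - 3 * s / 2) * (ent μ P + ent μ R) - (s + 1) * ent μ Q
    + (s ^ 2 / 2 + 3 * s / 2 + 1)
        * (ent μ (fun ω => (P ω, Q ω)) + ent μ (fun ω => (Q ω, R ω)))
    + s * (s + 2) * ent μ (fun ω => (P ω, R ω))
    - (s + 1) ^ 2 * ent μ (fun ω => (P ω, Q ω, R ω))

section Entropy

variable {Ω β γ δ ε : Type*} [Fintype Ω] {μ : Ω → ℝ}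

lemma pr_nonneg (hμ : ∀ ω, 0 ≤ μ ω) (X : Ω → β) (b : β) : 0 ≤ pr μ X b :=
  sum_nonneg fun ω _ => by split_ifs <;> simp [hμ ω]

lemma le_pr_self (hμ : ∀ ω, 0 ≤ μ ω) (X : Ω → β) (ω : Ω) : μ ω ≤ pr μ X (X ω) := by
  have := single_le_sum (f := fun ω' => if X ω' = X ω then μ ω' else 0)
    (fun ω' _ => by split_ifs <;> simp [hμ ω']) (mem_univ ω)
  simpa [pr] using this

lemma sum_pr_mul [Fintype β] (μ : Ω → ℝ) (X : Ω → β) (g : β → ℝ) :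
    ∑ b, pr μ X b * g b = ∑ ω, μ ω * g (X ω) := by
  simp only [pr, sum_mul, ite_mul, zero_mul]
  rw [sum_comm]
  simp

lemma sum_pr [Fintype β] (μ : Ω → ℝ) (X : Ω → β) : ∑ b, pr μ X b = ∑ ω, μ ω := by
  simpa using sum_pr_mul μ X fun _ => 1

lemma pr_eq_sum_pr_pair [Fintype γ] (μ : Ω → ℝ) (X : Ω → β) (Y : Ω → γ) (b : β) :
    pr μ X b = ∑ c, pr μ (fun ω => (X ω, Y ω)) (b, c) := by
  simp only [pr, Prod.mk.injEq, ite_and]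
  rw [sum_comm]
  refine sum_congr rfl fun ω _ => ?_
  split_ifs <;> simp

lemma pr_comp_injective (μ : Ω → ℝ) (X : Ω → β) {f : β → γ} (hf : f.Injective) (b : β) :
    pr μ (fun ω => f (X ω)) (f b) = pr μ X b := by
  simp [pr, hf.eq_iff]

/-- Pushing forward along `X` and then along `f` is pushing forward along `f ∘ X`. -/
lemma pr_pr [Fintype β] (μ : Ω → ℝ) (X : Ω → β) (f : β → γ) :
    pr (pr μ X) f = pr μ (fun ω => f (X ω)) := by
  funext c
  simpa [pr] using sum_pr_mul μ X fun b => if f b = c then 1 else 0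

variable [Fintype β] [Fintype γ] [Fintype δ] [Fintype ε]

lemma ent_pr (μ : Ω → ℝ) (X : Ω → β) (f : β → γ) :
    ent (pr μ X) f = ent μ (fun ω => f (X ω)) := by
  simp only [ent, pr_pr]

lemma mi_pr (μ : Ω → ℝ) (V : Ω → β) (f : β → γ) (g : β → δ) :
    mi (pr μ V) f g = mi μ (fun ω => f (V ω)) (fun ω => g (V ω)) := by
  simp only [mi, ent_pr]

lemma cmi_pr {ζ : Type*} [Fintype ζ] (μ : Ω → ℝ) (V : Ω → β) (f : β → γ) (g : β → δ)
    (k : β → ζ) :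
    cmi (pr μ V) f g k = cmi μ (fun ω => f (V ω)) (fun ω => g (V ω)) (fun ω => k (V ω)) := by
  simp only [cmi, ent_pr]

lemma ent_eq_sum (μ : Ω → ℝ) (X : Ω → β) :
    ent μ X = ∑ ω, μ ω * -Real.log (pr μ X (X ω)) := by
  rw [← sum_pr_mul μ X fun b => -Real.log (pr μ X b)]
  exact sum_congr rfl fun b _ => by rw [Real.negMulLog]; ring

/-- Entropy depends only on the partition of the sample space induced by the variable. -/
lemma ent_congr (μ : Ω → ℝ) {X : Ω → β} {Y : Ω → γ}
    (h : ∀ ω ω', X ω = X ω' ↔ Y ω = Y ω') : ent μ X = ent μ Y := by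
  simp only [ent_eq_sum, pr, h]

lemma cmi_nonneg (hμ : ∀ ω, 0 ≤ μ ω) (X : Ω → β) (Y : Ω → γ) (Z : Ω → δ) :
    0 ≤ cmi μ X Y Z := by
  set W := fun ω => (X ω, Y ω, Z ω)
  set p := pr μ W
  set u := pr μ fun ω => (X ω, Z ω)
  set v := pr μ fun ω => (Y ω, Z ω)
  set w := pr μ Z
  have hp : ∀ t, 0 ≤ p t := pr_nonneg hμ _
  have hu : ∀ t, 0 ≤ u t := pr_nonneg hμ _
  have hv : ∀ t, 0 ≤ v t := pr_nonneg hμ _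
  have hw : ∀ t, 0 ≤ w t := pr_nonneg hμ _
  let r : β × γ × δ → ℝ := fun t => u (t.1, t.2.2) * v t.2 / (p t * w t.2.2)
  have hu' : ∀ z, ∑ x, u (x, z) = w z := fun z => by
    rw [show w z = _ from pr_eq_sum_pr_pair μ Z X z]
    exact sum_congr rfl fun x _ =>
      (pr_comp_injective μ (fun ω => (X ω, Z ω)) Prod.swap_injective (x, z)).symm
  have hv' : ∀ z, ∑ y, v (y, z) = w z := fun z => by
    rw [show w z = _ from pr_eq_sum_pr_pair μ Z Y z]
    exact sum_congr rfl fun y _ =>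
      (pr_comp_injective μ (fun ω => (Y ω, Z ω)) Prod.swap_injective (y, z)).symm
  have hle : ∑ ω, μ ω * r (W ω) ≤ ∑ ω, μ ω := by
    rw [← sum_pr_mul μ W r, ← sum_pr μ Z]
    calc ∑ t, p t * r t ≤ ∑ t : β × γ × δ, u (t.1, t.2.2) * v t.2 / w t.2.2 := by
          refine sum_le_sum fun t _ => ?_
          have hq : 0 ≤ u (t.1, t.2.2) * v t.2 / w t.2.2 :=
            div_nonneg (mul_nonneg (hu _) (hv _)) (hw _)
          rcases (hp t).eq_or_lt with h | h
          · rw [← h, zero_mul]; exact hq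
          · refine le_of_eq ?_
            simp only [r]
            rw [mul_comm (p t) (w _), ← div_div, mul_div_cancel₀ _ h.ne']
      _ = ∑ z, w z := by
          simp only [Fintype.sum_prod_type]
          rw [sum_comm]
          calc _ = ∑ y, ∑ z, ∑ x, u (x, z) * v (y, z) / w z :=
                sum_congr rfl fun y _ => sum_comm
            _ = ∑ z, ∑ y, w z * v (y, z) / w z := by
                rw [sum_comm]; simp only [← sum_div, ← sum_mul, hu']
            _ = ∑ z, w z := by
                simp only [← sum_div, ← mul_sum, hv', mul_self_div_self]
  have key : ∀ ω, μ ω * (Real.log (u (X ω, Z ω)) + Real.log (v (Y ω, Z ω))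
      - Real.log (w (Z ω)) - Real.log (p (W ω))) ≤ μ ω * r (W ω) - μ ω := fun ω => by
    rcases (hμ ω).eq_or_lt with h | h
    · simp [← h]
    · have h1 : 0 < u (X ω, Z ω) := h.trans_le (le_pr_self hμ (fun ω => (X ω, Z ω)) ω)
      have h2 : 0 < v (Y ω, Z ω) := h.trans_le (le_pr_self hμ (fun ω => (Y ω, Z ω)) ω)
      have h3 : 0 < w (Z ω) := h.trans_le (le_pr_self hμ Z ω)
      have h4 : 0 < p (W ω) := h.trans_le (le_pr_self hμ W ω)
      have hr : 0 < r (W ω) := div_pos (mul_pos h1 h2) (mul_pos h4 h3)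
      have := Real.log_le_sub_one_of_pos hr
      rw [show Real.log (r (W ω)) = _ from Real.log_div (mul_pos h1 h2).ne' (mul_pos h4 h3).ne',
        Real.log_mul h1.ne' h2.ne', Real.log_mul h4.ne' h3.ne'] at this
      nlinarith
  have hsum := sum_le_sum fun ω (_ : ω ∈ univ) => key ω
  rw [sum_sub_distrib] at hsum
  have : cmi μ X Y Z = -∑ ω, μ ω * (Real.log (u (X ω, Z ω)) + Real.log (v (Y ω, Z ω))
      - Real.log (w (Z ω)) - Real.log (p (W ω))) := by
    simp only [cmi, ent_eq_sum, ← sum_add_distrib, ← sum_sub_distrib, ← sum_neg_distrib]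
    exact sum_congr rfl fun ω _ => by ring
  linarith

/-- Submodularity of entropy: `U` is the join of `X` and `Y`, and `I` is a common function
of `X` and `Y`. -/
lemma ent_submodular (hμ : ∀ ω, 0 ≤ μ ω) {X : Ω → β} {Y : Ω → γ} {I : Ω → δ} {U : Ω → ε}
    (hX : ∀ ω ω', X ω = X ω' → I ω = I ω') (hY : ∀ ω ω', Y ω = Y ω' → I ω = I ω')
    (hU : ∀ ω ω', U ω = U ω' ↔ X ω = X ω' ∧ Y ω = Y ω') :
    ent μ U + ent μ I ≤ ent μ X + ent μ Y := by
  have h := cmi_nonneg hμ X Y I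
  rw [cmi, ent_congr μ (X := fun ω => (X ω, I ω)) (Y := X) (by grind),
    ent_congr μ (X := fun ω => (Y ω, I ω)) (Y := Y) (by grind),
    ent_congr μ (X := fun ω => (X ω, Y ω, I ω)) (Y := U) (by grind)] at h
  linarith

lemma cmi_eq_zero_of_pr_eq_mul (hμ : ∀ ω, 0 ≤ μ ω) (X : Ω → β) (Y : Ω → γ) (Z : Ω → δ)
    (f : β → δ → ℝ) (g : γ → δ → ℝ)
    (h : ∀ x y z, pr μ (fun ω => (X ω, Y ω, Z ω)) (x, y, z) = f x z * g y z) :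
    cmi μ X Y Z = 0 := by
  have hXZ : ∀ x z, pr μ (fun ω => (X ω, Z ω)) (x, z) = f x z * ∑ y, g y z := fun x z => by
    rw [pr_eq_sum_pr_pair μ _ Y, mul_sum]
    refine sum_congr rfl fun y _ => ?_
    rw [← h]
    exact pr_comp_injective μ (fun ω => (X ω, Y ω, Z ω))
      (f := fun t => ((t.1, t.2.2), t.2.1)) (fun _ _ => by grind) (x, y, z)
  have hYZ : ∀ y z, pr μ (fun ω => (Y ω, Z ω)) (y, z) = (∑ x, f x z) * g y z := fun y z => by
    rw [pr_eq_sum_pr_pair μ _ X, sum_mul]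
    refine sum_congr rfl fun x _ => ?_
    rw [← h]
    exact pr_comp_injective μ (fun ω => (X ω, Y ω, Z ω))
      (f := fun t => (t.2, t.1)) (fun _ _ => by grind) (x, y, z)
  have hZ : ∀ z, pr μ Z z = (∑ x, f x z) * ∑ y, g y z := fun z => by
    rw [pr_eq_sum_pr_pair μ Z X, sum_mul]
    refine sum_congr rfl fun x _ => ?_
    rw [← hXZ]
    exact pr_comp_injective μ (fun ω => (X ω, Z ω)) Prod.swap_injective (x, z)
  simp only [cmi, ent_eq_sum, ← sum_add_distrib, ← sum_sub_distrib]
  refine sum_eq_zero fun ω _ => ?_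
  rcases (hμ ω).eq_or_lt with h0 | h0
  · simp [← h0]
  · have h1 := h0.trans_le (le_pr_self hμ (fun ω => (X ω, Z ω)) ω)
    have h2 := h0.trans_le (le_pr_self hμ (fun ω => (Y ω, Z ω)) ω)
    have h3 := h0.trans_le (le_pr_self hμ Z ω)
    have h4 := h0.trans_le (le_pr_self hμ (fun ω => (X ω, Y ω, Z ω)) ω)
    have hlog : Real.log (pr μ (fun ω => (X ω, Z ω)) (X ω, Z ω))
        + Real.log (pr μ (fun ω => (Y ω, Z ω)) (Y ω, Z ω))
        = Real.log (pr μ (fun ω => (X ω, Y ω, Z ω)) (X ω, Y ω, Z ω))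
        + Real.log (pr μ Z (Z ω)) := by
      rw [← Real.log_mul h1.ne' h2.ne', ← Real.log_mul h4.ne' h3.ne', hXZ, hYZ, hZ, h]
      congr 1
      ring
    linear_combination -μ ω * hlog

lemma mi_eq_zero_of_pr_eq_mul (hμ : ∀ ω, 0 ≤ μ ω) (hμ1 : ∑ ω, μ ω = 1)
    (X : Ω → β) (Y : Ω → γ) (f : β → ℝ) (g : γ → ℝ)
    (h : ∀ x y, pr μ (fun ω => (X ω, Y ω)) (x, y) = f x * g y) :
    mi μ X Y = 0 := by
  have h0 := cmi_eq_zero_of_pr_eq_mul hμ X Y (fun _ => ()) (fun x _ => f x) (fun y _ => g y)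
    fun x y z => by rw [← h]; simp [pr]
  have hc : ent μ (fun _ => ()) = 0 := by simp [ent, pr, hμ1]
  rw [cmi, hc, ent_congr μ (X := fun ω => (X ω, ())) (Y := X) (by simp),
    ent_congr μ (X := fun ω => (Y ω, ())) (Y := Y) (by simp),
    ent_congr μ (X := fun ω => (X ω, Y ω, ())) (Y := fun ω => (X ω, Y ω)) (by simp)] at h0
  rw [mi]
  linarith

end Entropy

section Copy

variable {W V E : Type*} [Fintype W] [Fintype V] [Fintype E]

/-- The adhesive extension of two distributions with a common marginal: `V` and `E` are
conditionally independent given `W`. -/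
lemma exists_adhesive_extension (p : W × V → ℝ) (q : W × E → ℝ) (hp : ∀ t, 0 ≤ p t)
    (hq : ∀ t, 0 ≤ q t) (h : pr p Prod.fst = pr q Prod.fst) :
    ∃ r : V × E × W → ℝ, (∀ t, 0 ≤ r t) ∧ pr r (fun t => (t.2.2, t.1)) = p ∧
      pr r (fun t => (t.2.2, t.2.1)) = q ∧
      cmi r (fun t => t.1) (fun t => t.2.1) (fun t => t.2.2) = 0 := by
  have hpm : ∀ w, pr p Prod.fst w = ∑ v, p (w, v) := fun w => by
    rw [pr_eq_sum_pr_pair p Prod.fst Prod.snd]; simp [pr]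
  have hqm : ∀ w, pr p Prod.fst w = ∑ e, q (w, e) := fun w => by
    rw [h, pr_eq_sum_pr_pair q Prod.fst Prod.snd]; simp [pr]
  set m := pr p Prod.fst
  have hm : ∀ w, 0 ≤ m w := pr_nonneg hp _
  let r : V × E × W → ℝ := fun t => p (t.2.2, t.1) * (q (t.2.2, t.2.1) / m t.2.2)
  have hr : ∀ t, 0 ≤ r t := fun t => mul_nonneg (hp _) (div_nonneg (hq _) (hm _))
  refine ⟨r, hr, ?_, ?_, ?_⟩
  · funext ⟨w, v⟩
    have : pr r (fun t => (t.2.2, t.1)) (w, v) = p (w, v) * (m w / m w) := by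
      simp only [pr, r, Fintype.sum_prod_type, Prod.mk.injEq, ite_and]
      simp [hqm, sum_div, mul_sum]
    rw [this]
    by_cases h0 : m w = 0
    · have := (sum_eq_zero_iff_of_nonneg fun v _ => hp (w, v)).1 ((hpm w).symm.trans h0) v
        (mem_univ v)
      simp [this]
    · simp [h0]
  · funext ⟨w, e⟩
    have : pr r (fun t => (t.2.2, t.2.1)) (w, e) = m w * (q (w, e) / m w) := by
      simp only [pr, r, Fintype.sum_prod_type, Prod.mk.injEq, ite_and]
      simp [hpm, sum_mul]
    rw [this]
    by_cases h0 : m w = 0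
    · have := (sum_eq_zero_iff_of_nonneg fun e _ => hq (w, e)).1 ((hqm w).symm.trans h0) e
        (mem_univ e)
      simp [this]
    · rw [mul_div_cancel₀ _ h0]
  · exact cmi_eq_zero_of_pr_eq_mul hr _ _ _ (fun v w => p (w, v)) (fun e w => q (w, e) / m w)
      fun v e w => by simp [pr, r]

end Copy

section Matus

/-- Symmetric penalty `I(A : E | B) + I(B : E | A)`. -/
noncomputable def crossInfo {Ω α β ε : Type*} [Fintype Ω] [Fintype α] [Fintype β] [Fintype ε]
    (μ : Ω → ℝ) (A : Ω → α) (B : Ω → β) (E : Ω → ε) : ℝ :=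
  cmi μ A E B + cmi μ B E A

universe u

variable {Ω α β δ ε : Type*} {γ : Type u} [Fintype Ω] [Fintype α] [Fintype β] [Fintype γ]
  [Fintype δ]
  [Fintype ε] {μ : Ω → ℝ}

lemma crossInfo_pr (μ : Ω → ℝ) (V : Ω → δ) (f : δ → α) (g : δ → β) (k : δ → ε) :
    crossInfo (pr μ V) f g k =
      crossInfo μ (fun ω => f (V ω)) (fun ω => g (V ω)) (fun ω => k (V ω)) := by
  simp only [crossInfo, cmi_pr]

lemma crossInfo_eq (μ : Ω → ℝ) (A : Ω → α) (B : Ω → β) (E : Ω → ε) :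
    crossInfo μ A B E = 2 * ent μ (fun ω => (A ω, B ω)) + ent μ (fun ω => (A ω, E ω))
      + ent μ (fun ω => (B ω, E ω)) - ent μ A - ent μ B
      - 2 * ent μ (fun ω => (A ω, B ω, E ω)) := by
  have h1 : ent μ (fun ω => (E ω, B ω)) = ent μ (fun ω => (B ω, E ω)) := ent_congr μ (by grind)
  have h2 : ent μ (fun ω => (E ω, A ω)) = ent μ (fun ω => (A ω, E ω)) := ent_congr μ (by grind)
  have h3 : ent μ (fun ω => (B ω, A ω)) = ent μ (fun ω => (A ω, B ω)) := ent_congr μ (by grind)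
  have h4 : ent μ (fun ω => (A ω, E ω, B ω)) = ent μ (fun ω => (A ω, B ω, E ω)) :=
    ent_congr μ (by grind)
  have h5 : ent μ (fun ω => (B ω, E ω, A ω)) = ent μ (fun ω => (A ω, B ω, E ω)) :=
    ent_congr μ (by grind)
  simp only [crossInfo, cmi]
  linarith

lemma cmi_pair_pair_eq (μ : Ω → ℝ) (A : Ω → α) (B : Ω → β) (C : Ω → γ) (D : Ω → δ)
    (E : Ω → ε) :
    cmi μ (fun ω => (C ω, D ω)) E (fun ω => (A ω, B ω)) =
      ent μ (fun ω => (A ω, B ω, C ω, D ω)) + ent μ (fun ω => (A ω, B ω, E ω))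
        - ent μ (fun ω => (A ω, B ω)) - ent μ (fun ω => (A ω, B ω, C ω, D ω, E ω)) := by
  have h1 : ent μ (fun ω => ((C ω, D ω), A ω, B ω)) = ent μ (fun ω => (A ω, B ω, C ω, D ω)) :=
    ent_congr μ (by grind)
  have h2 : ent μ (fun ω => (E ω, A ω, B ω)) = ent μ (fun ω => (A ω, B ω, E ω)) :=
    ent_congr μ (by grind)
  have h3 : ent μ (fun ω => ((C ω, D ω), E ω, A ω, B ω)) =
      ent μ (fun ω => (A ω, B ω, C ω, D ω, E ω)) := ent_congr μ (by grind)
  simp only [cmi]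
  linarith

lemma crossInfo_pair_le (hμ : ∀ ω, 0 ≤ μ ω) (A : Ω → α) (B : Ω → β) (C : Ω → γ) (D : Ω → δ)
    (E : Ω → ε) (h : cmi μ (fun ω => (C ω, D ω)) E (fun ω => (A ω, B ω)) = 0) :
    crossInfo μ A B (fun ω => (C ω, E ω)) ≤ crossInfo μ A B C + crossInfo μ A B E := by
  have hED : ent μ (fun ω => (A ω, B ω, C ω, D ω, E ω)) + ent μ (fun ω => (A ω, B ω, C ω)) ≤
      ent μ (fun ω => (A ω, B ω, C ω, D ω)) + ent μ (fun ω => (A ω, B ω, C ω, E ω)) :=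
    ent_submodular hμ (by grind) (by grind) (by grind)
  have hA : ent μ (fun ω => (A ω, C ω, E ω)) + ent μ A ≤
      ent μ (fun ω => (A ω, C ω)) + ent μ (fun ω => (A ω, E ω)) :=
    ent_submodular hμ (by grind) (by grind) (by grind)
  have hB : ent μ (fun ω => (B ω, C ω, E ω)) + ent μ B ≤
      ent μ (fun ω => (B ω, C ω)) + ent μ (fun ω => (B ω, E ω)) :=
    ent_submodular hμ (by grind) (by grind) (by grind)
  rw [cmi_pair_pair_eq] at h
  simp only [crossInfo_eq]
  linarith

lemma mi_le_of_cmi_eq_zero (hμ : ∀ ω, 0 ≤ μ ω) (A : Ω → α) (B : Ω → β) (C : Ω → γ) (D : Ω → δ)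
    (E : Ω → ε) (h : cmi μ (fun ω => (C ω, D ω)) E (fun ω => (A ω, B ω)) = 0) :
    mi μ A B ≤ cmi μ A B E + cmi μ A B C - cmi μ A B (fun ω => (C ω, E ω))
      + crossInfo μ A B E + cmi μ A B D + mi μ C D := by
  have hCD_E : ent μ (fun ω => (C ω, D ω, E ω)) + ent μ E ≤
      ent μ (fun ω => (C ω, E ω)) + ent μ (fun ω => (D ω, E ω)) :=
    ent_submodular hμ (by grind) (by grind) (by grind)
  have hABE_CD : ent μ (fun ω => (A ω, B ω, C ω, D ω, E ω)) + ent μ (fun ω => (C ω, D ω)) ≤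
      ent μ (fun ω => (A ω, B ω, C ω, D ω)) + ent μ (fun ω => (C ω, D ω, E ω)) :=
    ent_submodular hμ (by grind) (by grind) (by grind)
  have hAB_DE : ent μ (fun ω => (A ω, B ω, D ω, E ω)) + ent μ (fun ω => (D ω, E ω)) ≤
      ent μ (fun ω => (A ω, D ω, E ω)) + ent μ (fun ω => (B ω, D ω, E ω)) :=
    ent_submodular hμ (by grind) (by grind) (by grind)
  have hDE_A : ent μ (fun ω => (A ω, D ω, E ω)) + ent μ A ≤
      ent μ (fun ω => (A ω, D ω)) + ent μ (fun ω => (A ω, E ω)) :=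
    ent_submodular hμ (by grind) (by grind) (by grind)
  have hDE_B : ent μ (fun ω => (B ω, D ω, E ω)) + ent μ B ≤
      ent μ (fun ω => (B ω, D ω)) + ent μ (fun ω => (B ω, E ω)) :=
    ent_submodular hμ (by grind) (by grind) (by grind)
  have hCE_A : ent μ (fun ω => (A ω, C ω, E ω)) + ent μ A ≤
      ent μ (fun ω => (A ω, C ω)) + ent μ (fun ω => (A ω, E ω)) :=
    ent_submodular hμ (by grind) (by grind) (by grind)
  have hCE_B : ent μ (fun ω => (B ω, C ω, E ω)) + ent μ B ≤
      ent μ (fun ω => (B ω, C ω)) + ent μ (fun ω => (B ω, E ω)) :=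
    ent_submodular hμ (by grind) (by grind) (by grind)
  have hDE_ABC : ent μ (fun ω => (A ω, B ω, C ω, D ω, E ω)) + ent μ (fun ω => (A ω, B ω, C ω)) ≤
      ent μ (fun ω => (A ω, B ω, C ω, D ω)) + ent μ (fun ω => (A ω, B ω, C ω, E ω)) :=
    ent_submodular hμ (by grind) (by grind) (by grind)
  have hCE_ABD : ent μ (fun ω => (A ω, B ω, C ω, D ω, E ω)) + ent μ (fun ω => (A ω, B ω, D ω)) ≤
      ent μ (fun ω => (A ω, B ω, C ω, D ω)) + ent μ (fun ω => (A ω, B ω, D ω, E ω)) :=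
    ent_submodular hμ (by grind) (by grind) (by grind)
  rw [cmi_pair_pair_eq] at h
  simp only [crossInfo_eq, cmi, mi]
  linarith

/-- Iterating the copy construction: `E` plays the role of `n + 1` copies of `C` that are
conditionally independent given `(A, B)`. -/
lemma exists_copies (hμ : ∀ ω, 0 ≤ μ ω) (A : Ω → α) (B : Ω → β) (C : Ω → γ) (D : Ω → δ) (n : ℕ) :
    ∃ (E : Type u) (_ : Fintype E) (q : (α × β) × E → ℝ), (∀ t, 0 ≤ q t) ∧
      pr q Prod.fst = pr μ (fun ω => (A ω, B ω)) ∧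
      crossInfo q (fun t => t.1.1) (fun t => t.1.2) Prod.snd ≤ (n + 1) * crossInfo μ A B C ∧
      n * mi μ A B ≤ (n + 1) * cmi μ A B C
        - cmi q (fun t => t.1.1) (fun t => t.1.2) Prod.snd
        + n * (n + 1) / 2 * crossInfo μ A B C + n * (cmi μ A B D + mi μ C D) := by
  induction n with
  | zero =>
    refine ⟨γ, inferInstance, pr μ (fun ω => ((A ω, B ω), C ω)), pr_nonneg hμ _,
      pr_pr _ _ _, ?_, ?_⟩ <;>
    simp [crossInfo_pr, cmi_pr]
  | succ n ih =>
    obtain ⟨E, _, q, hq, hqm, hK, hI⟩ := ih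
    obtain ⟨r, hr, hrp, hrq, hrc⟩ := exists_adhesive_extension
      (pr μ (fun ω => ((A ω, B ω), C ω, D ω))) q (pr_nonneg hμ _) hq ((pr_pr _ _ _).trans hqm.symm)
    let A' : (γ × δ) × E × α × β → α := fun t => t.2.2.1
    let B' : (γ × δ) × E × α × β → β := fun t => t.2.2.2
    let C' : (γ × δ) × E × α × β → γ := fun t => t.1.1
    let D' : (γ × δ) × E × α × β → δ := fun t => t.1.2
    let E' : (γ × δ) × E × α × β → E := fun t => t.2.1
    have key := mi_le_of_cmi_eq_zero hr A' B' C' D' E' hrc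
    have hK' := crossInfo_pair_le hr A' B' C' D' E' hrc
    have hAB : mi r A' B' = mi μ A B := by
      have := mi_pr r (fun t => (t.2.2, t.1)) (fun t => t.1.1) (fun t => t.1.2)
      rwa [hrp, mi_pr, eq_comm] at this
    have hCD : mi r C' D' = mi μ C D := by
      have := mi_pr r (fun t => (t.2.2, t.1)) (fun t => t.2.1) (fun t => t.2.2)
      rwa [hrp, mi_pr, eq_comm] at this
    have hABC : cmi r A' B' C' = cmi μ A B C := by
      have := cmi_pr r (fun t => (t.2.2, t.1)) (fun t => t.1.1) (fun t => t.1.2) (fun t => t.2.1)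
      rwa [hrp, cmi_pr, eq_comm] at this
    have hABD : cmi r A' B' D' = cmi μ A B D := by
      have := cmi_pr r (fun t => (t.2.2, t.1)) (fun t => t.1.1) (fun t => t.1.2) (fun t => t.2.2)
      rwa [hrp, cmi_pr, eq_comm] at this
    have hKC : crossInfo r A' B' C' = crossInfo μ A B C := by
      have := crossInfo_pr r (fun t => (t.2.2, t.1)) (fun t => t.1.1) (fun t => t.1.2)
        (fun t => t.2.1)
      rwa [hrp, crossInfo_pr, eq_comm] at this
    have hABE : cmi r A' B' E' = cmi q (fun t => t.1.1) (fun t => t.1.2) Prod.snd := by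
      rw [← hrq, cmi_pr]
    have hKE : crossInfo r A' B' E' = crossInfo q (fun t => t.1.1) (fun t => t.1.2) Prod.snd := by
      rw [← hrq, crossInfo_pr]
    refine ⟨γ × E, inferInstance, pr r (fun t => (t.2.2, t.1.1, t.2.1)), pr_nonneg hr _,
      ?_, ?_, ?_⟩
    · rw [← hqm, ← hrq, pr_pr, pr_pr]
    · rw [crossInfo_pr]
      push_cast
      linarith
    · rw [cmi_pr]
      push_cast
      linarith

/-- The Matúš inequality for `(P, R; Q, D)` when `I(P : R | D) = 0` and `I(Q : D) = 0`. -/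
lemma matusMarg1_of_indep (hμ : ∀ ω, 0 ≤ μ ω) (P : Ω → α) (Q : Ω → γ) (R : Ω → β) (D : Ω → δ)
    (hPR : cmi μ P R D = 0) (hQD : mi μ Q D = 0) (s : ℕ) : matusMarg1 (s : ℝ) μ P Q R := by
  obtain ⟨E, _, q, hq, -, -, h⟩ := exists_copies hμ P R Q D s
  have h0 := cmi_nonneg hq (fun t => t.1.1) (fun t => t.1.2) Prod.snd
  have h1 : ent μ (fun ω => (Q ω, R ω)) = ent μ (fun ω => (R ω, Q ω)) := ent_congr μ (by grind)
  have h2 : ent μ (fun ω => (P ω, Q ω, R ω)) = ent μ (fun ω => (P ω, R ω, Q ω)) :=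
    ent_congr μ (by grind)
  generalize cmi q (fun t => t.1.1) (fun t => t.1.2) Prod.snd = a at h h0
  rw [hPR, hQD, crossInfo_eq, cmi, mi] at h
  rw [matusMarg1, h1, h2]
  linarith

end Matus

section Triangle

variable {Ω SX SY SZ SA SB SC : Type*} [Fintype Ω] [Fintype SX] [Fintype SY] [Fintype SZ]
  [Fintype SA] [Fintype SB] [Fintype SC] {μ : Ω → ℝ}

/-- In the triangle structure the inequality holds with `X` in the middle role. -/
lemma matusMarg1_of_triangle (hμ0 : ∀ ω, 0 ≤ μ ω) (hμ1 : ∑ ω, μ ω = 1)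
    (X : Ω → SX) (Y : Ω → SY) (Z : Ω → SZ) (A : Ω → SA) (B : Ω → SB) (C : Ω → SC)
    {pA : SA → ℝ} {pB : SB → ℝ} {pC : SC → ℝ}
    {qX : SX → SB → SC → ℝ} {qY : SY → SA → SC → ℝ} {qZ : SZ → SA → SB → ℝ}
    (hqX1 : ∀ b c, ∑ x, qX x b c = 1) (hqY1 : ∀ a c, ∑ y, qY y a c = 1)
    (hqZ1 : ∀ a b, ∑ z, qZ z a b = 1)
    (hfact : ∀ x y z a b c,
      pr μ (fun ω => (X ω, Y ω, Z ω, A ω, B ω, C ω)) (x, y, z, a, b, c)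
        = pA a * pB b * pC c * qX x b c * qY y a c * qZ z a b) (s : ℕ) :
    matusMarg1 (s : ℝ) μ Y X Z ∧ matusMarg1 (s : ℝ) μ Z X Y := by
  have hYZ : cmi μ Y Z A = 0 := by
    refine cmi_eq_zero_of_pr_eq_mul hμ0 Y Z A (fun y a => pA a * ∑ c, pC c * qY y a c)
      (fun z a => ∑ b, pB b * qZ z a b) fun y z a => ?_
    rw [pr_eq_sum_pr_pair μ _ (fun ω => (C ω, B ω, X ω))]
    have : ∀ c b x, pr μ (fun ω => ((Y ω, Z ω, A ω), C ω, B ω, X ω)) ((y, z, a), c, b, x) =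
        pA a * (pC c * qY y a c) * (pB b * qZ z a b) * qX x b c := fun c b x => by
      rw [← pr_comp_injective μ _ (f := fun t : (SY × SZ × SA) × SC × SB × SX =>
        (t.2.2.2, t.1.1, t.1.2.1, t.1.2.2, t.2.2.1, t.2.1)) (fun _ _ => by grind), hfact]
      ring
    simp only [Fintype.sum_prod_type, this, ← mul_sum, hqX1, mul_one, ← sum_mul]
  have hXA : mi μ X A = 0 := by
    refine mi_eq_zero_of_pr_eq_mul hμ0 hμ1 X A (fun x => ∑ b, ∑ c, pB b * pC c * qX x b c)
      pA fun x a => ?_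
    rw [pr_eq_sum_pr_pair μ _ (fun ω => (B ω, C ω, Y ω, Z ω))]
    have : ∀ b c y z, pr μ (fun ω => ((X ω, A ω), B ω, C ω, Y ω, Z ω)) ((x, a), b, c, y, z) =
        pB b * pC c * qX x b c * pA a * qY y a c * qZ z a b := fun b c y z => by
      rw [← pr_comp_injective μ _ (f := fun t : (SX × SA) × SB × SC × SY × SZ =>
        (t.1.1, t.2.2.2.1, t.2.2.2.2, t.1.2, t.2.1, t.2.2.1)) (fun _ _ => by grind), hfact]
      ring
    simp only [Fintype.sum_prod_type, this, ← mul_sum, hqZ1, hqY1, mul_one, ← sum_mul]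
  have hZY : cmi μ Z Y A = 0 := by
    rw [← hYZ, cmi, cmi, ent_congr μ (X := fun ω => (Z ω, Y ω, A ω))
      (Y := fun ω => (Y ω, Z ω, A ω)) (by grind)]
    ring
  exact ⟨matusMarg1_of_indep hμ0 Y X Z A hYZ hXA s, matusMarg1_of_indep hμ0 Z X Y A hZY hXA s⟩

end Triangle

/-- **Proposition 4, family (14).** For every distribution compatible with the classical
triangle causal structure and every integer `s ≥ 1`, the inequality `matusMarg1` holds
for `(X, Y, Z)` and all permutations of the roles of `X`, `Y` and `Z`. -/
theorem triangle_matus_marg1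
    {Ω SX SY SZ SA SB SC : Type*} [Fintype Ω] [Fintype SX] [Fintype SY] [Fintype SZ]
    [Fintype SA] [Fintype SB] [Fintype SC]
    (μ : Ω → ℝ) (hμ0 : ∀ ω, 0 ≤ μ ω) (hμ1 : ∑ ω, μ ω = 1)
    (X : Ω → SX) (Y : Ω → SY) (Z : Ω → SZ) (A : Ω → SA) (B : Ω → SB) (C : Ω → SC)
    (pA : SA → ℝ) (pB : SB → ℝ) (pC : SC → ℝ)
    (qX : SX → SB → SC → ℝ) (qY : SY → SA → SC → ℝ) (qZ : SZ → SA → SB → ℝ)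
    (hpA0 : ∀ a, 0 ≤ pA a) (hpA1 : ∑ a, pA a = 1)
    (hpB0 : ∀ b, 0 ≤ pB b) (hpB1 : ∑ b, pB b = 1)
    (hpC0 : ∀ c, 0 ≤ pC c) (hpC1 : ∑ c, pC c = 1)
    (hqX0 : ∀ x b c, 0 ≤ qX x b c) (hqX1 : ∀ b c, ∑ x, qX x b c = 1)
    (hqY0 : ∀ y a c, 0 ≤ qY y a c) (hqY1 : ∀ a c, ∑ y, qY y a c = 1)
    (hqZ0 : ∀ z a b, 0 ≤ qZ z a b) (hqZ1 : ∀ a b, ∑ z, qZ z a b = 1)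
    (hfact : ∀ x y z a b c,
      pr μ (fun ω => (X ω, Y ω, Z ω, A ω, B ω, C ω)) (x, y, z, a, b, c)
        = pA a * pB b * pC c * qX x b c * qY y a c * qZ z a b)
    (s : ℕ) (hs : 1 ≤ s) :
    matusMarg1 (s : ℝ) μ X Y Z ∧ matusMarg1 (s : ℝ) μ X Z Y ∧
    matusMarg1 (s : ℝ) μ Y X Z ∧ matusMarg1 (s : ℝ) μ Y Z X ∧
    matusMarg1 (s : ℝ) μ Z X Y ∧ matusMarg1 (s : ℝ) μ Z Y X := by
  obtain ⟨hYXZ, hZXY⟩ :=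
    matusMarg1_of_triangle hμ0 hμ1 X Y Z A B C hqX1 hqY1 hqZ1 hfact s
  obtain ⟨hXYZ, hZYX⟩ :=
    matusMarg1_of_triangle hμ0 hμ1 Y X Z B A C (pA := pB) (pB := pA) (pC := pC)
      (qX := qY) (qY := qX) (qZ := fun z b a => qZ z a b) hqY1 hqX1 (fun b a => hqZ1 a b)
      (fun y x z b a c => by
        rw [← pr_comp_injective μ _ (f := fun t : SY × SX × SZ × SB × SA × SC =>
          (t.2.1, t.1, t.2.2.1, t.2.2.2.2.1, t.2.2.2.1, t.2.2.2.2.2)) (fun _ _ => by grind), hfact]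
        ring) s
  obtain ⟨hYZX, hXZY⟩ :=
    matusMarg1_of_triangle hμ0 hμ1 Z Y X C B A (pA := pC) (pB := pB) (pC := pA)
      (qX := fun z b a => qZ z a b) (qY := fun y c a => qY y a c) (qZ := fun x c b => qX x b c)
      (fun b a => hqZ1 a b) (fun c a => hqY1 a c) (fun c b => hqX1 b c)
      (fun z y x c b a => by
        rw [← pr_comp_injective μ _ (f := fun t : SZ × SY × SX × SC × SB × SA =>
          (t.2.2.1, t.2.1, t.1, t.2.2.2.2.2, t.2.2.2.2.1, t.2.2.2.1)) (fun _ _ => by grind), hfact]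
        ring) s
  exact ⟨hXYZ, hXZY, hYXZ, hYZX, hZXY, hZYX⟩
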